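/- Decomposition of invariant measures: Let P be a stochastic matrix on a countable state space S in which every state is positive recurrent, and let S = ∪_i S_i be the decomposition of S into irreducible (communicating) classes with representatives b_i ∈ S_i. Then every probability π on S with πP = π is a convex combination (possibly countably infinite) of the cycle measures π^{(b_i)}. -/

import Mathlib

open scoped ENNReal Classical
noncomputable section

/-- `n`-step transition probabilities of the stochastic matrix `p`. -/
def pPow {S : Type*} (p : S → S → ℝ≥0∞) : ℕ → S → S → ℝ≥0∞
  | 0, i, j => if i = j then 1 else 0
  | n + 1, i, j => ∑' k, pPow p n i k * p k j

/-- `i` and `j` communicate. -/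
def Communicates {S : Type*} (p : S → S → ℝ≥0∞) (i j : S) : Prop :=
  (∃ n, 0 < pPow p n i j) ∧ (∃ n, 0 < pPow p n j i)

/-- `taboo p b n j = P_b(X_n = j, X_1 ≠ b, …, X_n ≠ b) = P_b(X_n = j, 𝔱_b > n)`. -/
def taboo {S : Type*} (p : S → S → ℝ≥0∞) (b : S) : ℕ → S → ℝ≥0∞
  | 0, j => if j = b then 1 else 0
  | n + 1, j => if j = b then 0 else ∑' i, taboo p b n i * p i j

/-- `E_b[Σ_{n=0}^{𝔱_b−1} 1(X_n = a)]`. -/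
def cycNum {S : Type*} (p : S → S → ℝ≥0∞) (b a : S) : ℝ≥0∞ := ∑' n, taboo p b n a

/-- `E_b[𝔱_b] = Σ_n P_b(𝔱_b > n)`. -/
def meanRet {S : Type*} (p : S → S → ℝ≥0∞) (b : S) : ℝ≥0∞ := ∑' n, ∑' j, taboo p b n j

/-- The cycle (occupation) measure `π^{(b)}`. -/
def cyc {S : Type*} (p : S → S → ℝ≥0∞) (b a : S) : ℝ≥0∞ := cycNum p b a / meanRet p b

section InvariantMeasures

variable {S : Type*} {p : S → S → ℝ≥0∞}

lemma taboo_succ_self (b : S) (n : ℕ) : taboo p b (n + 1) b = 0 := by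
  simp [taboo]

lemma taboo_succ_of_ne {b j : S} (h : j ≠ b) (n : ℕ) :
    taboo p b (n + 1) j = ∑' i, taboo p b n i * p i j := by
  simp [taboo, h]

lemma cycNum_self (b : S) : cycNum p b b = 1 := by
  rw [cycNum, tsum_eq_single 0]
  · simp [taboo]
  · intro n hn
    obtain ⟨m, rfl⟩ := Nat.exists_eq_succ_of_ne_zero hn
    exact taboo_succ_self b m

lemma tsum_cycNum (b : S) : ∑' a, cycNum p b a = meanRet p b :=
  ENNReal.tsum_comm

lemma meanRet_ne_zero (b : S) : meanRet p b ≠ 0 := by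
  have h : cycNum p b b ≤ meanRet p b := tsum_cycNum (p := p) b ▸ ENNReal.le_tsum b
  rw [cycNum_self] at h
  exact (zero_lt_one.trans_le h).ne'

lemma cycNum_of_ne {b j : S} (h : j ≠ b) :
    cycNum p b j = ∑' i, cycNum p b i * p i j := by
  rw [cycNum, tsum_eq_zero_add' ENNReal.summable]
  simp only [taboo_succ_of_ne h, cycNum, ← ENNReal.tsum_mul_right]
  rw [ENNReal.tsum_comm]
  simp [taboo, h]

/-- The unnormalized cycle measure of a positive recurrent state is invariant. -/
lemma cycNum_invariant (hstoch : ∀ i, ∑' j, p i j = 1) {b : S} (hb : meanRet p b < ⊤) (j : S) :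
    cycNum p b j = ∑' i, cycNum p b i * p i j := by
  by_cases hj : j = b
  swap
  · exact cycNum_of_ne hj
  subst hj
  have hmass : ∑' j', ∑' i, cycNum p j i * p i j' = ∑' j', cycNum p j j' := by
    rw [ENNReal.tsum_comm]
    simp [ENNReal.tsum_mul_left, hstoch]
  rw [ENNReal.tsum_eq_add_tsum_ite j,
    ENNReal.tsum_eq_add_tsum_ite (f := fun j' => cycNum p j j') j] at hmass
  have hrest : ∑' x, (if x = j then 0 else ∑' i, cycNum p j i * p i x) =
      ∑' x, if x = j then 0 else cycNum p j x := by
    refine tsum_congr fun x => ?_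
    split_ifs with hx
    · rfl
    · exact (cycNum_of_ne hx).symm
  rw [hrest] at hmass
  have hfin : ∑' x, (if x = j then 0 else cycNum p j x) ≠ ⊤ := by
    refine ne_top_of_le_ne_top hb.ne ?_
    rw [← tsum_cycNum]
    refine ENNReal.tsum_le_tsum fun x => ?_
    split_ifs <;> simp
  exact ((ENNReal.add_left_inj hfin).1 hmass).symm

/-- An invariant measure dominates each of its cycle measures. -/
lemma mul_cycNum_le {π : S → ℝ≥0∞} (hπ : ∀ j, π j = ∑' i, π i * p i j) (b a : S) :
    π b * cycNum p b a ≤ π a := by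
  have key : ∀ N a, π b * ∑ n ∈ Finset.range N, taboo p b n a ≤ π a := by
    intro N
    induction N with
    | zero => simp
    | succ N ih =>
      intro a
      by_cases ha : a = b
      · subst ha
        rw [Finset.sum_range_succ']
        simp [taboo]
      · rw [Finset.sum_range_succ']
        simp only [taboo_succ_of_ne ha]
        rw [hπ a, ← Summable.tsum_finsetSum fun _ _ => ENNReal.summable]
        simp only [taboo, ha, if_false, add_zero, ← Finset.sum_mul]
        rw [← ENNReal.tsum_mul_left]
        refine ENNReal.tsum_le_tsum fun i => ?_
        rw [← mul_assoc]
        gcongr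
        exact ih i
  rw [cycNum, ENNReal.tsum_eq_iSup_nat, ENNReal.mul_iSup]
  exact iSup_le fun N => key N a

lemma mul_pPow_le {π : S → ℝ≥0∞} (hπ : ∀ j, π j = ∑' i, π i * p i j) (n : ℕ) (i j : S) :
    π i * pPow p n i j ≤ π j := by
  induction n generalizing j with
  | zero =>
    by_cases h : i = j
    · simp [pPow, h]
    · simp [pPow, h]
  | succ n ih =>
    rw [pPow, ← ENNReal.tsum_mul_left, hπ j]
    refine ENNReal.tsum_le_tsum fun k => ?_
    rw [← mul_assoc]
    gcongr
    exact ih k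

/-- A finite invariant measure agrees with its cycle measure at `b` on the states leading
to `b`. -/
lemma eq_mul_cycNum (hstoch : ∀ i, ∑' j, p i j = 1) {b : S} (hb : meanRet p b < ⊤)
    {π : S → ℝ≥0∞} (hfin : ∀ a, π a ≠ ⊤) (hπ : ∀ j, π j = ∑' i, π i * p i j)
    {a : S} (ha : ∃ n, 0 < pPow p n a b) : π a = π b * cycNum p b a := by
  set D : S → ℝ≥0∞ := fun x => π x - π b * cycNum p b x with hD
  have hle := mul_cycNum_le hπ b
  have hadd : ∀ x, D x + π b * cycNum p b x = π x := fun x => tsub_add_cancel_of_le (hle x)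
  have hDinv : ∀ j, D j = ∑' i, D i * p i j := by
    intro j
    have hne : π b * cycNum p b j ≠ ⊤ := ne_top_of_le_ne_top (hfin j) (hle j)
    refine (ENNReal.add_left_inj hne).1 ?_
    rw [hadd, hπ j]
    conv_rhs => rw [cycNum_invariant hstoch hb j, ← ENNReal.tsum_mul_left, ← ENNReal.tsum_add]
    refine tsum_congr fun i => ?_
    rw [← mul_assoc, ← add_mul, hadd]
  obtain ⟨n, hn⟩ := ha
  have hDb : D b = 0 := by simp [hD, cycNum_self]
  have h0 : D a * pPow p n a b = 0 := le_zero_iff.1 (hDb ▸ mul_pPow_le hDinv n a b)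
  have hDa : D a = 0 := (mul_eq_zero.1 h0).resolve_right hn.ne'
  rw [← hadd a, hDa, zero_add]

lemma taboo_le_pPow (b : S) (n : ℕ) (j : S) : taboo p b n j ≤ pPow p n b j := by
  induction n generalizing j with
  | zero => simp [taboo, pPow, eq_comm]
  | succ n ih =>
    by_cases hj : j = b
    · subst hj
      simp [taboo]
    · rw [taboo_succ_of_ne hj, pPow]
      refine ENNReal.tsum_le_tsum fun i => ?_
      gcongr
      exact ih i

lemma mul_pPow_le_pPow_succ (i k : S) (n : ℕ) (j : S) :
    p i k * pPow p n k j ≤ pPow p (n + 1) i j := by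
  induction n generalizing j with
  | zero =>
    by_cases h : k = j
    · subst h
      simp only [pPow, if_true, mul_one]
      exact le_trans (by simp) (ENNReal.le_tsum i)
    · simp [pPow, h]
  | succ n ih =>
    rw [pPow, pPow, ← ENNReal.tsum_mul_left]
    refine ENNReal.tsum_le_tsum fun l => ?_
    rw [← mul_assoc]
    gcongr
    exact ih l

/-- The cycle measure of a positive recurrent state `b` charges only states leading to `b`. -/
lemma exists_pPow_pos_of_cycNum_ne_zero (hstoch : ∀ i, ∑' j, p i j = 1) {b : S}
    (hb : meanRet p b < ⊤) {a : S} (ha : cycNum p b a ≠ 0) : ∃ n, 0 < pPow p n a b := by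
  by_contra hab
  set C : Set S := {x | ¬ ∃ n, 0 < pPow p n x b} with hC
  have hbC : b ∉ C := by
    simp only [hC, Set.mem_ofPred_eq, not_not]
    exact ⟨0, by simp [pPow]⟩
  have hclosed : ∀ i ∈ C, ∀ j, j ∉ C → p i j = 0 := by
    intro i hi j hj
    by_contra hij
    obtain ⟨n, hn⟩ := not_not.1 hj
    exact hi ⟨n + 1, (ENNReal.mul_pos hij hn.ne').trans_le (mul_pPow_le_pPow_succ i j n b)⟩
  have hrow : ∀ i ∈ C, ∑' j, C.indicator (p i) j = 1 := by
    intro i hi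
    rw [← hstoch i]
    refine tsum_congr fun j => ?_
    by_cases hj : j ∈ C
    · simp [hj]
    · simp [hj, hclosed i hi j hj]
  set f : ℕ → ℝ≥0∞ := fun n => ∑' j, C.indicator (taboo p b n) j with hf
  have hmono : Monotone f := by
    refine monotone_nat_of_le_succ fun n => ?_
    calc f n = ∑' i, ∑' j, C.indicator (taboo p b n) i * C.indicator (p i) j := by
          refine tsum_congr fun i => ?_
          rw [ENNReal.tsum_mul_left]
          by_cases hi : i ∈ C
          · rw [hrow i hi, mul_one]
          · simp [hi]
      _ = ∑' j, ∑' i, C.indicator (taboo p b n) i * C.indicator (p i) j := ENNReal.tsum_comm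
      _ ≤ f (n + 1) := by
          refine ENNReal.tsum_le_tsum fun j => ?_
          by_cases hj : j ∈ C
          · have hjb : j ≠ b := fun h => hbC (h ▸ hj)
            simp only [Set.indicator_of_mem hj]
            rw [taboo_succ_of_ne hjb]
            refine ENNReal.tsum_le_tsum fun i => ?_
            gcongr
            exact Set.indicator_le_self _ _ _
          · simp [hj]
  obtain ⟨n, hn⟩ : ∃ n, taboo p b n a ≠ 0 := by
    by_contra! h
    exact ha (by simp [cycNum, h])
  have hfn : f n ≠ 0 := by
    have h : C.indicator (taboo p b n) a ≤ f n := ENNReal.le_tsum a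
    rw [Set.indicator_of_mem (show a ∈ C from hab)] at h
    exact ((pos_iff_ne_zero.2 hn).trans_le h).ne'
  refine hb.ne (top_le_iff.1 ?_)
  calc (⊤ : ℝ≥0∞) = ∑' _ : ℕ, f n := (ENNReal.tsum_const_eq_top_of_ne_zero hfn).symm
    _ ≤ ∑' m, f (m + n) := ENNReal.tsum_le_tsum fun m => hmono (Nat.le_add_left n m)
    _ ≤ ∑' m, f m := ENNReal.tsum_comp_le_tsum_of_injective (add_left_injective n) f
    _ ≤ meanRet p b := ENNReal.tsum_le_tsum fun m =>
        ENNReal.tsum_le_tsum fun j => Set.indicator_le_self _ _ _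

lemma communicates_of_cycNum_ne_zero (hstoch : ∀ i, ∑' j, p i j = 1) {b : S}
    (hb : meanRet p b < ⊤) {a : S} (ha : cycNum p b a ≠ 0) : Communicates p a b := by
  refine ⟨exists_pPow_pos_of_cycNum_ne_zero hstoch hb ha, ?_⟩
  by_contra! h
  refine ha (ENNReal.tsum_eq_zero.2 fun n => ?_)
  exact le_zero_iff.1 ((taboo_le_pPow b n a).trans (h n))

lemma tsum_cyc {b : S} (hb : meanRet p b < ⊤) : ∑' a, cyc p b a = 1 := by
  simp only [cyc, div_eq_mul_inv]
  rw [ENNReal.tsum_mul_right, tsum_cycNum]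
  exact ENNReal.mul_inv_cancel (meanRet_ne_zero b) hb.ne

lemma meanRet_mul_cyc {b : S} (hb : meanRet p b < ⊤) (a : S) :
    meanRet p b * cyc p b a = cycNum p b a :=
  ENNReal.mul_div_cancel (meanRet_ne_zero b) hb.ne

end InvariantMeasures

/-- Decomposition of invariant measures: if every state is positive recurrent and
`r` selects a representative of each communicating class, then every invariant
probability `π` is a convex combination of the cycle measures of the representatives. -/
theorem invariant_measure_decomposition {S : Type*} [Countable S] (p : S → S → ℝ≥0∞)
    (hstoch : ∀ i, ∑' j, p i j = 1)
    (hposrec : ∀ b, meanRet p b < ⊤)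
    (r : S → S) (hr : ∀ i, Communicates p i (r i))
    (hrclass : ∀ i j, Communicates p i j → r i = r j)
    (π : S → ℝ≥0∞) (hπ1 : ∑' a, π a = 1)
    (hπinv : ∀ j, π j = ∑' i, π i * p i j) :
    ∃ c : S → ℝ≥0∞, (∀ s, s ∉ Set.range r → c s = 0) ∧ (∑' s, c s = 1) ∧
      ∀ a, π a = ∑' s, c s * cyc p s a := by
  have hfin : ∀ a, π a ≠ ⊤ := fun a =>
    ne_top_of_le_ne_top (hπ1 ▸ ENNReal.one_ne_top) (ENNReal.le_tsum a)
  set c : S → ℝ≥0∞ := (Set.range r).indicator fun s => π s * meanRet p s with hc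
  have hdecomp : ∀ a, π a = ∑' s, c s * cyc p s a := by
    intro a
    rw [tsum_eq_single (r a)]
    · rw [hc, Set.indicator_of_mem (Set.mem_range_self a), mul_assoc,
        meanRet_mul_cyc (hposrec _)]
      exact eq_mul_cycNum hstoch (hposrec _) hfin hπinv (hr a).1
    · intro s hs
      by_cases hsr : s ∈ Set.range r
      · obtain ⟨i, rfl⟩ := hsr
        rw [hc, Set.indicator_of_mem (Set.mem_range_self i), mul_assoc,
          meanRet_mul_cyc (hposrec _)]
        by_contra h
        have hcomm := communicates_of_cycNum_ne_zero hstoch (hposrec _) (right_ne_zero_of_mul h)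
        exact hs ((hrclass i (r i) (hr i)).trans (hrclass a (r i) hcomm).symm)
      · simp [hc, hsr]
  refine ⟨c, fun s hs => Set.indicator_of_notMem hs _, ?_, hdecomp⟩
  calc ∑' s, c s = ∑' s, ∑' a, c s * cyc p s a := by
        simp [ENNReal.tsum_mul_left, tsum_cyc (hposrec _)]
    _ = ∑' a, ∑' s, c s * cyc p s a := ENNReal.tsum_comm
    _ = ∑' a, π a := tsum_congr fun a => (hdecomp a).symm
    _ = 1 := hπ1
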